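/- For every integer k ≥ 1 there exists a constant C > 0, depending only on k, with the following property: for every real polynomial q in two variables of total degree at most k−1 that vanishes at the three vertices of the reference triangle T̂ and has ∫_{T̂} q dx dy = 0, there exists a pair of polynomials v = (v₁,v₂) of total degree at most k, vanishing at every point of ∂T̂, such that ∂₁v₁ + ∂₂v₂ = q and ∫_{T̂} (v₁² + v₂² + |∇v₁|² + |∇v₂|²) dx dy ≤ C ∫_{T̂} q² dx dy. -/

import Mathlib

open MvPolynomial MeasureTheory

/-- The reference triangle `T̂ = {(x,y) : x ≥ 0, y ≥ 0, x + y ≤ 1}`. -/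
def Tref : Set (ℝ × ℝ) := {p | 0 ≤ p.1 ∧ 0 ≤ p.2 ∧ p.1 + p.2 ≤ 1}

/-- `(x,y)` lies on the boundary of the reference triangle. -/
def OnBdryT (x y : ℝ) : Prop :=
  0 ≤ x ∧ 0 ≤ y ∧ x + y ≤ 1 ∧ (x = 0 ∨ y = 0 ∨ x + y = 1)

/-! ### Analysis on the reference triangle -/

lemma isClosed_Tref : IsClosed Tref := by
  have : Tref = {p : ℝ × ℝ | 0 ≤ p.1} ∩ ({p | 0 ≤ p.2} ∩ {p | p.1 + p.2 ≤ 1}) := rfl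
  rw [this]
  exact (isClosed_le (by fun_prop) (by fun_prop)).inter
    ((isClosed_le (by fun_prop) (by fun_prop)).inter (isClosed_le (by fun_prop) (by fun_prop)))

lemma isCompact_Tref : IsCompact Tref := by
  refine (isCompact_Icc (a := ((0 : ℝ), (0 : ℝ))) (b := (1, 1))).of_isClosed_subset
    isClosed_Tref ?_
  rintro ⟨x, y⟩ ⟨hx, hy, hxy⟩
  simp only at hx hy hxy
  exact ⟨⟨hx, hy⟩, ⟨by simp only; linarith, by simp only; linarith⟩⟩

lemma continuous_eval_pair (p : MvPolynomial (Fin 2) ℝ) :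
    Continuous fun z : ℝ × ℝ => eval ![z.1, z.2] p := by
  refine (MvPolynomial.continuous_eval p).comp (continuous_pi fun i => ?_)
  fin_cases i
  · exact continuous_fst
  · exact continuous_snd

lemma integrableOn_Tref {f : ℝ × ℝ → ℝ} (hf : Continuous f) : IntegrableOn f Tref :=
  hf.continuousOn.integrableOn_compact isCompact_Tref

lemma eq_zero_of_setIntegral_Tref_eq_zero {p : MvPolynomial (Fin 2) ℝ}
    (h0 : ∀ z ∈ Tref, 0 ≤ eval ![z.1, z.2] p) (h : ∫ z in Tref, eval ![z.1, z.2] p = 0) :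
    p = 0 := by
  have hae := (setIntegral_eq_zero_iff_of_nonneg_ae
    ((ae_restrict_iff' isClosed_Tref.measurableSet).2 (ae_of_all _ h0))
    (integrableOn_Tref (continuous_eval_pair p))).1 h
  let U : Set (ℝ × ℝ) := Set.Ioo 0 (1 / 2) ×ˢ Set.Ioo 0 (1 / 2)
  have hU : U ⊆ Tref := by
    rintro ⟨x, y⟩ ⟨⟨hx, hx'⟩, ⟨hy, hy'⟩⟩
    simp only at hx hx' hy hy'
    exact ⟨hx.le, hy.le, by simp only; linarith⟩
  have heq := Measure.eqOn_open_of_ae_eq (ae_restrict_of_ae_restrict_of_subset hU hae)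
    (isOpen_Ioo.prod isOpen_Ioo) (continuous_eval_pair p).continuousOn continuousOn_const
  refine funext_set (fun _ : Fin 2 => Set.Ioo (0 : ℝ) (1 / 2))
    (fun _ => Set.Ioo_infinite (by norm_num)) fun x hx => ?_
  have hx2 : x = ![x 0, x 1] := by
    ext i; fin_cases i <;> rfl
  rw [hx2, map_zero]
  exact heq (x := (x 0, x 1)) ⟨hx 0 trivial, hx 1 trivial⟩

lemma hasDerivAt_eval_fst (p : MvPolynomial (Fin 2) ℝ) (x y : ℝ) :
    HasDerivAt (fun t => eval ![t, y] p) (eval ![x, y] (pderiv 0 p)) x := by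
  induction p using MvPolynomial.induction_on with
  | C a => simpa using hasDerivAt_const x a
  | add p q hp hq => simpa using! hp.add hq
  | mul_X p i hp =>
    fin_cases i
    · simpa [pderiv_X, mul_comm, add_comm] using! (hasDerivAt_id x).mul hp
    · simpa [pderiv_X, mul_comm] using hp.mul_const y

lemma hasDerivAt_eval_snd (p : MvPolynomial (Fin 2) ℝ) (x y : ℝ) :
    HasDerivAt (fun t => eval ![x, t] p) (eval ![x, y] (pderiv 1 p)) y := by
  induction p using MvPolynomial.induction_on with
  | C a => simpa using hasDerivAt_const y a
  | add p q hp hq => simpa using! hp.add hq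
  | mul_X p i hp =>
    fin_cases i
    · simpa [pderiv_X, mul_comm] using hp.mul_const x
    · simpa [pderiv_X, mul_comm, add_comm] using! (hasDerivAt_id y).mul hp

lemma integral_pderiv_zero {v : MvPolynomial (Fin 2) ℝ}
    (hv : ∀ x y, OnBdryT x y → eval ![x, y] v = 0) :
    ∫ z in Tref, eval ![z.1, z.2] (pderiv 0 v) = 0 := by
  have hc := continuous_eval_pair (pderiv 0 v)
  rw [← integral_indicator isClosed_Tref.measurableSet, Measure.volume_eq_prod,
    integral_prod_symm _ ((integrableOn_Tref hc).integrable_indicator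
      isClosed_Tref.measurableSet)]
  refine integral_eq_zero_of_ae (ae_of_all _ fun y => ?_)
  by_cases hy : 0 ≤ y ∧ y ≤ 1
  · have h1 : (fun x => Tref.indicator (fun z : ℝ × ℝ => eval ![z.1, z.2] (pderiv 0 v)) (x, y))
        = (Set.Icc 0 (1 - y)).indicator fun x => eval ![x, y] (pderiv 0 v) := by
      ext x
      refine Set.indicator_eq_indicator ?_ rfl
      simp only [Tref, Set.mem_ofPred_eq, Set.mem_Icc]
      constructor
      · rintro ⟨h, -, h'⟩; exact ⟨h, by linarith⟩
      · rintro ⟨h, h'⟩; exact ⟨h, hy.1, by linarith⟩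
    simp only [h1, Pi.zero_apply]
    rw [integral_indicator measurableSet_Icc, integral_Icc_eq_integral_Ioc,
      ← intervalIntegral.integral_of_le (by linarith),
      intervalIntegral.integral_eq_sub_of_hasDerivAt (fun x _ => hasDerivAt_eval_fst v x y)
        ((hc.comp (by fun_prop : Continuous fun x : ℝ => (x, y))).intervalIntegrable _ _),
      hv _ _ ⟨by linarith, hy.1, by linarith, Or.inr (Or.inr (by ring))⟩,
      hv _ _ ⟨le_rfl, hy.1, by linarith, Or.inl rfl⟩, sub_zero]
  · have h1 : ∀ x, Tref.indicator (fun z : ℝ × ℝ => eval ![z.1, z.2] (pderiv 0 v)) (x, y) = 0 :=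
      fun x => Set.indicator_of_notMem (s := Tref) (a := (x, y))
        (fun h : 0 ≤ x ∧ 0 ≤ y ∧ x + y ≤ 1 => hy ⟨h.2.1, by linarith⟩) _
    simp [h1]

lemma integral_pderiv_one {v : MvPolynomial (Fin 2) ℝ}
    (hv : ∀ x y, OnBdryT x y → eval ![x, y] v = 0) :
    ∫ z in Tref, eval ![z.1, z.2] (pderiv 1 v) = 0 := by
  have hc := continuous_eval_pair (pderiv 1 v)
  rw [← integral_indicator isClosed_Tref.measurableSet, Measure.volume_eq_prod,
    integral_prod _ ((integrableOn_Tref hc).integrable_indicator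
      isClosed_Tref.measurableSet)]
  refine integral_eq_zero_of_ae (ae_of_all _ fun x => ?_)
  by_cases hx : 0 ≤ x ∧ x ≤ 1
  · have h1 : (fun y => Tref.indicator (fun z : ℝ × ℝ => eval ![z.1, z.2] (pderiv 1 v)) (x, y))
        = (Set.Icc 0 (1 - x)).indicator fun y => eval ![x, y] (pderiv 1 v) := by
      ext y
      refine Set.indicator_eq_indicator ?_ rfl
      simp only [Tref, Set.mem_ofPred_eq, Set.mem_Icc]
      constructor
      · rintro ⟨-, h, h'⟩; exact ⟨h, by linarith⟩
      · rintro ⟨h, h'⟩; exact ⟨hx.1, h, by linarith⟩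
    simp only [h1, Pi.zero_apply]
    rw [integral_indicator measurableSet_Icc, integral_Icc_eq_integral_Ioc,
      ← intervalIntegral.integral_of_le (by linarith),
      intervalIntegral.integral_eq_sub_of_hasDerivAt (fun y _ => hasDerivAt_eval_snd v x y)
        ((hc.comp (by fun_prop : Continuous fun y : ℝ => (x, y))).intervalIntegrable _ _),
      hv _ _ ⟨hx.1, by linarith, by linarith, Or.inr (Or.inr (by ring))⟩,
      hv _ _ ⟨hx.1, le_rfl, by linarith, Or.inr (Or.inl rfl)⟩, sub_zero]
  · have h1 : ∀ y, Tref.indicator (fun z : ℝ × ℝ => eval ![z.1, z.2] (pderiv 1 v)) (x, y) = 0 :=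
      fun y => Set.indicator_of_notMem (s := Tref) (a := (x, y))
        (fun h : 0 ≤ x ∧ 0 ≤ y ∧ x + y ≤ 1 => hx ⟨h.1, by linarith⟩) _
    simp [h1]

/-! ### Divergences of polynomial fields vanishing on the boundary -/

/-- The cubic bubble function of the reference triangle. -/
noncomputable def bubble : MvPolynomial (Fin 2) ℝ := X 0 * X 1 * (1 - X 0 - X 1)

lemma totalDegree_bubble_mul_le (a c : ℕ) :
    (bubble * (X 0 ^ a * X 1 ^ c)).totalDegree ≤ a + c + 3 := by
  have h1 : (1 - X 0 - X 1 : MvPolynomial (Fin 2) ℝ).totalDegree ≤ 1 := by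
    refine (totalDegree_sub _ _).trans (max_le ((totalDegree_sub _ _).trans (max_le ?_ ?_)) ?_) <;>
      simp
  have h2 : (X 0 * X 1 : MvPolynomial (Fin 2) ℝ).totalDegree ≤ 2 :=
    (totalDegree_mul _ _).trans (by simp)
  have h3 : (X 0 ^ a * X 1 ^ c : MvPolynomial (Fin 2) ℝ).totalDegree ≤ a + c :=
    (totalDegree_mul _ _).trans (by simp)
  have h4 := totalDegree_mul (X 0 * X 1 : MvPolynomial (Fin 2) ℝ) (1 - X 0 - X 1)
  refine (totalDegree_mul _ _).trans ?_
  unfold bubble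
  omega

lemma eval_eq_zero_of_bubble_dvd {v : MvPolynomial (Fin 2) ℝ} (hv : bubble ∣ v) {x y : ℝ}
    (h : OnBdryT x y) : eval ![x, y] v = 0 := by
  obtain ⟨w, rfl⟩ := hv
  have hb : eval ![x, y] bubble = 0 := by
    obtain ⟨-, -, -, rfl | rfl | h⟩ := h
    · simp [bubble]
    · simp [bubble]
    · obtain rfl : y = 1 - x := by linarith
      simp [bubble]
  simp [hb]

/-- Pairs of polynomials of total degree at most `k` divisible by the bubble function. -/
noncomputable def bubbleFields (k : ℕ) :
    Submodule ℝ (MvPolynomial (Fin 2) ℝ × MvPolynomial (Fin 2) ℝ) :=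
  ((restrictTotalDegree (Fin 2) ℝ k).prod (restrictTotalDegree (Fin 2) ℝ k)) ⊓
    ((Ideal.span {bubble}).restrictScalars ℝ).prod ((Ideal.span {bubble}).restrictScalars ℝ)

lemma mem_bubbleFields {k : ℕ} {v : MvPolynomial (Fin 2) ℝ × MvPolynomial (Fin 2) ℝ} :
    v ∈ bubbleFields k ↔ (v.1.totalDegree ≤ k ∧ v.2.totalDegree ≤ k) ∧
      bubble ∣ v.1 ∧ bubble ∣ v.2 := by
  simp [bubbleFields, Submodule.mem_prod, mem_restrictTotalDegree, Ideal.mem_span_singleton,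
    and_and_and_comm]

/-- The divergence of a pair of polynomials, as a linear map. -/
noncomputable def polyDiv :
    MvPolynomial (Fin 2) ℝ × MvPolynomial (Fin 2) ℝ →ₗ[ℝ] MvPolynomial (Fin 2) ℝ :=
  LinearMap.coprod (pderiv 0).toLinearMap (pderiv 1).toLinearMap

lemma polyDiv_apply (v : MvPolynomial (Fin 2) ℝ × MvPolynomial (Fin 2) ℝ) :
    polyDiv v = pderiv 0 v.1 + pderiv 1 v.2 := rfl

/-- Divergences of the fields in `bubbleFields k`. -/
noncomputable def bubbleDiv (k : ℕ) : Submodule ℝ (MvPolynomial (Fin 2) ℝ) :=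
  (bubbleFields k).map polyDiv

lemma bubbleDiv_mono {k l : ℕ} (h : k ≤ l) : bubbleDiv k ≤ bubbleDiv l :=
  Submodule.map_mono fun v hv => by
    rw [mem_bubbleFields] at hv ⊢
    exact ⟨⟨hv.1.1.trans h, hv.1.2.trans h⟩, hv.2⟩

lemma pderiv_zero_bubble_mul_mem {k a c : ℕ} (h : a + c + 3 ≤ k) :
    pderiv 0 (bubble * (X 0 ^ a * X 1 ^ c)) ∈ bubbleDiv k :=
  ⟨(bubble * (X 0 ^ a * X 1 ^ c), 0), mem_bubbleFields.2
    ⟨⟨(totalDegree_bubble_mul_le a c).trans h, by simp⟩, dvd_mul_right _ _, dvd_zero _⟩,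
    by simp [polyDiv_apply]⟩

lemma pderiv_one_bubble_mul_mem {k a c : ℕ} (h : a + c + 3 ≤ k) :
    pderiv 1 (bubble * (X 0 ^ a * X 1 ^ c)) ∈ bubbleDiv k :=
  ⟨(0, bubble * (X 0 ^ a * X 1 ^ c)), mem_bubbleFields.2
    ⟨⟨by simp, (totalDegree_bubble_mul_le a c).trans h⟩, dvd_zero _, dvd_mul_right _ _⟩,
    by simp [polyDiv_apply]⟩

/-- The compatibility conditions on a divergence: it vanishes at the vertices and has zero
integral. -/
def VertexMeanZero (q : MvPolynomial (Fin 2) ℝ) : Prop :=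
  eval ![0, 0] q = 0 ∧ eval ![1, 0] q = 0 ∧ eval ![0, 1] q = 0 ∧
    (∫ p in Tref, eval ![p.1, p.2] q) = 0

lemma VertexMeanZero.add {p q : MvPolynomial (Fin 2) ℝ} (hp : VertexMeanZero p)
    (hq : VertexMeanZero q) : VertexMeanZero (p + q) := by
  obtain ⟨h1, h2, h3, h4⟩ := hp
  obtain ⟨h1', h2', h3', h4'⟩ := hq
  refine ⟨by simp [h1, h1'], by simp [h2, h2'], by simp [h3, h3'], ?_⟩
  simp only [map_add]
  rw [integral_add (integrableOn_Tref (continuous_eval_pair p))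
    (integrableOn_Tref (continuous_eval_pair q)), h4, h4', add_zero]

lemma VertexMeanZero.sub {p q : MvPolynomial (Fin 2) ℝ} (hp : VertexMeanZero p)
    (hq : VertexMeanZero q) : VertexMeanZero (p - q) := by
  obtain ⟨h1, h2, h3, h4⟩ := hp
  obtain ⟨h1', h2', h3', h4'⟩ := hq
  refine ⟨by simp [h1, h1'], by simp [h2, h2'], by simp [h3, h3'], ?_⟩
  simp only [map_sub]
  rw [integral_sub (integrableOn_Tref (continuous_eval_pair p))
    (integrableOn_Tref (continuous_eval_pair q)), h4, h4', sub_zero]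

lemma vertexMeanZero_of_mem_bubbleDiv {k : ℕ} {q : MvPolynomial (Fin 2) ℝ}
    (hq : q ∈ bubbleDiv k) : VertexMeanZero q := by
  obtain ⟨v, hv, rfl⟩ := hq
  obtain ⟨-, h1, h2⟩ := mem_bubbleFields.1 hv
  rw [polyDiv_apply]
  refine VertexMeanZero.add ?_ ?_
  · have hi := integral_pderiv_zero fun x y => eval_eq_zero_of_bubble_dvd h1
    obtain ⟨w, hw⟩ := h1
    refine ⟨?_, ?_, ?_, hi⟩ <;> simp [hw, bubble, pderiv_X]
  · have hi := integral_pderiv_one fun x y => eval_eq_zero_of_bubble_dvd h2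
    obtain ⟨w, hw⟩ := h2
    refine ⟨?_, ?_, ?_, hi⟩ <;> simp [hw, bubble, pderiv_X]

/-! ### Reduction of the degree -/

lemma restrictTotalDegree_le_of_X_pow_mem {n : ℕ} {S : Submodule ℝ (MvPolynomial (Fin 2) ℝ)}
    (h : ∀ i j, i + j ≤ n → X 0 ^ i * X 1 ^ j ∈ S) : restrictTotalDegree (Fin 2) ℝ n ≤ S := by
  rw [restrictTotalDegree, restrictSupport_eq_span, Submodule.span_le]
  rintro _ ⟨s, hs, rfl⟩
  have hs' : s 0 + s 1 ≤ n := by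
    simpa [Finsupp.sum_fintype] using hs
  have : (monomial s (1 : ℝ)) = X 0 ^ s 0 * X 1 ^ s 1 := by
    simp [monomial_eq, Finsupp.prod_fintype]
  simpa only [this, SetLike.mem_coe] using h _ _ hs'

lemma X_pow_mul_X_pow_mem_restrictTotalDegree {n i j : ℕ} (h : i + j ≤ n) :
    X 0 ^ i * X 1 ^ j ∈ restrictTotalDegree (Fin 2) ℝ n := by
  rw [mem_restrictTotalDegree]
  exact (totalDegree_mul _ _).trans (by simpa using h)

lemma C_two : (C (2 : ℝ) : MvPolynomial (Fin 2) ℝ) = 2 := map_ofNat C 2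

lemma smul_add_smul_mem_of_pderiv_zero (a c : ℕ) :
    ((a : ℝ) + 2) • (X 0 ^ (a + 1) * X 1 ^ (c + 1) : MvPolynomial (Fin 2) ℝ) +
      ((a : ℝ) + 1) • (X 0 ^ a * X 1 ^ (c + 2)) ∈
      bubbleDiv (a + c + 3) ⊔ restrictTotalDegree (Fin 2) ℝ (a + c + 1) := by
  have h : ((a : ℝ) + 2) • (X 0 ^ (a + 1) * X 1 ^ (c + 1) : MvPolynomial (Fin 2) ℝ) +
      ((a : ℝ) + 1) • (X 0 ^ a * X 1 ^ (c + 2)) =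
      -pderiv 0 (bubble * (X 0 ^ a * X 1 ^ c)) + ((a : ℝ) + 1) • (X 0 ^ a * X 1 ^ (c + 1)) := by
    have hb : (bubble * (X 0 ^ a * X 1 ^ c)) =
        X 0 ^ (a + 1) * X 1 ^ (c + 1) - X 0 ^ (a + 2) * X 1 ^ (c + 1)
          - X 0 ^ (a + 1) * X 1 ^ (c + 2) := by
      unfold bubble; ring
    rw [hb]
    simp [pderiv_X, smul_eq_C_mul, C_two]
    ring
  rw [h]
  exact Submodule.add_mem_sup (neg_mem (pderiv_zero_bubble_mul_mem le_rfl))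
    (Submodule.smul_mem _ _ (X_pow_mul_X_pow_mem_restrictTotalDegree (by omega)))

lemma smul_add_smul_mem_of_pderiv_one (a c : ℕ) :
    ((c : ℝ) + 1) • (X 0 ^ (a + 2) * X 1 ^ c : MvPolynomial (Fin 2) ℝ) +
      ((c : ℝ) + 2) • (X 0 ^ (a + 1) * X 1 ^ (c + 1)) ∈
      bubbleDiv (a + c + 3) ⊔ restrictTotalDegree (Fin 2) ℝ (a + c + 1) := by
  have h : ((c : ℝ) + 1) • (X 0 ^ (a + 2) * X 1 ^ c : MvPolynomial (Fin 2) ℝ) +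
      ((c : ℝ) + 2) • (X 0 ^ (a + 1) * X 1 ^ (c + 1)) =
      -pderiv 1 (bubble * (X 0 ^ a * X 1 ^ c)) + ((c : ℝ) + 1) • (X 0 ^ (a + 1) * X 1 ^ c) := by
    have hb : (bubble * (X 0 ^ a * X 1 ^ c)) =
        X 0 ^ (a + 1) * X 1 ^ (c + 1) - X 0 ^ (a + 2) * X 1 ^ (c + 1)
          - X 0 ^ (a + 1) * X 1 ^ (c + 2) := by
      unfold bubble; ring
    rw [hb]
    simp [pderiv_X, smul_eq_C_mul, C_two]
    ring
  rw [h]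
  exact Submodule.add_mem_sup (neg_mem (pderiv_one_bubble_mul_mem le_rfl))
    (Submodule.smul_mem _ _ (X_pow_mul_X_pow_mem_restrictTotalDegree (by omega)))

lemma X_pow_mul_X_pow_mem_bubbleDiv_sup (n : ℕ) :
    ∀ i j, i + j = n + 3 → (X 0 ^ i * X 1 ^ j : MvPolynomial (Fin 2) ℝ) ∈
      bubbleDiv (n + 4) ⊔ restrictTotalDegree (Fin 2) ℝ (n + 2) := by
  set S := bubbleDiv (n + 4) ⊔ restrictTotalDegree (Fin 2) ℝ (n + 2) with hS
  have h0 : ∀ a c : ℕ, a + c = n + 1 →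
      ((a : ℝ) + 2) • (X 0 ^ (a + 1) * X 1 ^ (c + 1) : MvPolynomial (Fin 2) ℝ) +
        ((a : ℝ) + 1) • (X 0 ^ a * X 1 ^ (c + 2)) ∈ S := by
    intro a c h
    simpa only [h] using smul_add_smul_mem_of_pderiv_zero a c
  have h1 : ∀ a c : ℕ, a + c = n + 1 →
      ((c : ℝ) + 1) • (X 0 ^ (a + 2) * X 1 ^ c : MvPolynomial (Fin 2) ℝ) +
        ((c : ℝ) + 2) • (X 0 ^ (a + 1) * X 1 ^ (c + 1)) ∈ S := by
    intro a c h
    simpa only [h] using smul_add_smul_mem_of_pderiv_one a c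
  have hone : (X 0 ^ 1 * X 1 ^ (n + 2) : MvPolynomial (Fin 2) ℝ) ∈ S := by
    have e0 := h0 1 n (by omega)
    have e1 := h1 0 (n + 1) (by omega)
    have hne : (n : ℝ) + 5 ≠ 0 := by positivity
    refine (S.smul_mem_iff hne).1 ?_
    convert sub_mem (S.smul_mem (3 : ℝ) e1) (S.smul_mem ((n : ℝ) + 2) e0) using 1
    push_cast
    module
  have hzero : (X 0 ^ 0 * X 1 ^ (n + 3) : MvPolynomial (Fin 2) ℝ) ∈ S := by
    have e0 := h0 0 (n + 1) (by omega)
    convert sub_mem e0 (S.smul_mem (2 : ℝ) hone) using 1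
    push_cast
    module
  have hlow : ∀ i j, i + (j + 1) = n + 3 →
      (X 0 ^ i * X 1 ^ (j + 1) : MvPolynomial (Fin 2) ℝ) ∈ S := by
    intro i
    induction i with
    | zero =>
      intro j hj
      obtain rfl : j = n + 2 := by omega
      exact hzero
    | succ i ih =>
      intro j hj
      have hne : (i : ℝ) + 2 ≠ 0 := by positivity
      refine (S.smul_mem_iff hne).1 ?_
      convert sub_mem (h0 i j (by omega)) (S.smul_mem ((i : ℝ) + 1) (ih (j + 1) (by omega)))
        using 1
      module
  intro i j hij
  obtain _ | j := j
  · obtain rfl : i = n + 3 := by omega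
    convert sub_mem (h1 (n + 1) 0 (by omega)) (S.smul_mem (2 : ℝ) (hlow (n + 2) 0 (by omega)))
      using 1
    push_cast
    module
  · exact hlow i j hij

lemma restrictTotalDegree_le_bubbleDiv_sup (n : ℕ) :
    restrictTotalDegree (Fin 2) ℝ (n + 2) ≤
      bubbleDiv (n + 3) ⊔ restrictTotalDegree (Fin 2) ℝ 2 := by
  induction n with
  | zero => exact le_sup_right
  | succ n ih =>
    have h : restrictTotalDegree (Fin 2) ℝ (n + 3) ≤
        bubbleDiv (n + 4) ⊔ restrictTotalDegree (Fin 2) ℝ (n + 2) := by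
      refine restrictTotalDegree_le_of_X_pow_mem fun i j hij => ?_
      obtain hij | hij : i + j ≤ n + 2 ∨ i + j = n + 3 := by omega
      · exact Submodule.mem_sup_right (X_pow_mul_X_pow_mem_restrictTotalDegree hij)
      · exact X_pow_mul_X_pow_mem_bubbleDiv_sup n i j hij
    exact h.trans (sup_le le_sup_left
      (ih.trans (sup_le_sup_right (bubbleDiv_mono (by omega)) _)))

lemma exists_coeffs_of_totalDegree_le_two {q : MvPolynomial (Fin 2) ℝ}
    (hq : q.totalDegree ≤ 2) : ∃ a b c d e f : ℝ,
      q = C a + C b * X 0 + C c * X 1 + C d * X 0 ^ 2 + C e * (X 0 * X 1) + C f * X 1 ^ 2 := by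
  have h : restrictTotalDegree (Fin 2) ℝ 2 ≤
      Submodule.span ℝ {1, X 0, X 1, X 0 ^ 2, X 0 * X 1, X 1 ^ 2} := by
    refine restrictTotalDegree_le_of_X_pow_mem fun i j hij => Submodule.subset_span ?_
    have hi : i ≤ 2 := by omega
    have hj : j ≤ 2 := by omega
    interval_cases i <;> interval_cases j <;> first | omega | simp
  have hq' := h ((mem_restrictTotalDegree _ _ _).2 hq)
  simp only [Submodule.mem_span_insert, Submodule.mem_span_singleton] at hq'
  obtain ⟨a, _, ⟨b, _, ⟨c, _, ⟨d, _, ⟨e, _, ⟨f, rfl⟩, rfl⟩, rfl⟩, rfl⟩, rfl⟩, rfl⟩ := hq'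
  refine ⟨a, b, c, d, e, f, ?_⟩
  simp only [smul_eq_C_mul]
  ring

lemma exists_coeffs_of_totalDegree_le_one {q : MvPolynomial (Fin 2) ℝ}
    (hq : q.totalDegree ≤ 1) : ∃ a b c : ℝ, q = C a + C b * X 0 + C c * X 1 := by
  have h : restrictTotalDegree (Fin 2) ℝ 1 ≤ Submodule.span ℝ {1, X 0, X 1} := by
    refine restrictTotalDegree_le_of_X_pow_mem fun i j hij => Submodule.subset_span ?_
    have hi : i ≤ 1 := by omega
    have hj : j ≤ 1 := by omega
    interval_cases i <;> interval_cases j <;> first | omega | simp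
  have hq' := h ((mem_restrictTotalDegree _ _ _).2 hq)
  simp only [Submodule.mem_span_insert, Submodule.mem_span_singleton] at hq'
  obtain ⟨a, _, ⟨b, _, ⟨c, rfl⟩, rfl⟩, rfl⟩ := hq'
  refine ⟨a, b, c, ?_⟩
  simp only [smul_eq_C_mul]
  ring

lemma eq_zero_of_totalDegree_le_one {q : MvPolynomial (Fin 2) ℝ} (hq : q.totalDegree ≤ 1)
    (h : VertexMeanZero q) : q = 0 := by
  obtain ⟨a, b, c, rfl⟩ := exists_coeffs_of_totalDegree_le_one hq
  obtain ⟨h1, h2, h3, -⟩ := h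
  simp at h1 h2 h3
  obtain rfl := h1
  simp at h2 h3
  simp [h2, h3]

lemma X_mul_X_eq_zero_of_integral {e : ℝ}
    (h : ∫ p in Tref, eval ![p.1, p.2] (C e * (X 0 * X 1)) = 0) : e = 0 := by
  by_contra he
  have h2 : ∫ p in Tref, eval ![p.1, p.2] (X 0 * X 1 : MvPolynomial (Fin 2) ℝ) = 0 := by
    simp only [map_mul, eval_C] at h ⊢
    rw [integral_const_mul] at h
    exact (mul_eq_zero.1 h).resolve_left he
  have h3 := eq_zero_of_setIntegral_Tref_eq_zero (fun z hz => by
    simpa using mul_nonneg hz.1 hz.2.1) h2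
  simp at h3

lemma mem_bubbleDiv_of_totalDegree_le_two {q : MvPolynomial (Fin 2) ℝ} (hq : q.totalDegree ≤ 2)
    (h : VertexMeanZero q) : q ∈ bubbleDiv 3 := by
  obtain ⟨a, b, c, d, e, f, rfl⟩ := exists_coeffs_of_totalDegree_le_two hq
  have hmem : b • pderiv 1 (bubble * (X 0 ^ 0 * X 1 ^ 0)) +
      c • pderiv 0 (bubble * (X 0 ^ 0 * X 1 ^ 0)) ∈ bubbleDiv 3 :=
    add_mem (Submodule.smul_mem _ _ (pderiv_one_bubble_mul_mem le_rfl))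
      (Submodule.smul_mem _ _ (pderiv_zero_bubble_mul_mem le_rfl))
  have hsub := (h.sub (vertexMeanZero_of_mem_bubbleDiv hmem)).2.2.2
  obtain ⟨h1, h2, h3, -⟩ := h
  simp at h1 h2 h3
  obtain rfl := h1
  obtain rfl : d = -b := by linarith
  obtain rfl : f = -c := by linarith
  have heq : C 0 + C b * X 0 + C c * X 1 + C (-b) * X 0 ^ 2 + C e * (X 0 * X 1) + C (-c) * X 1 ^ 2
      - (b • pderiv 1 (bubble * (X 0 ^ 0 * X 1 ^ 0)) +
        c • pderiv 0 (bubble * (X 0 ^ 0 * X 1 ^ 0))) = C (e + 2 * b + 2 * c) * (X 0 * X 1) := by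
    simp [bubble, pderiv_X, smul_eq_C_mul, C_two]
    ring
  rw [heq] at hsub
  rw [X_mul_X_eq_zero_of_integral hsub, map_zero, zero_mul, zero_add] at heq
  rw [map_zero, zero_add, sub_eq_zero.1 heq]
  exact hmem

theorem mem_bubbleDiv {k : ℕ} {q : MvPolynomial (Fin 2) ℝ} (hq : q.totalDegree ≤ k - 1)
    (h : VertexMeanZero q) : q ∈ bubbleDiv k := by
  obtain hk | ⟨n, rfl⟩ : k ≤ 2 ∨ ∃ n, k = n + 3 := by
    obtain hk | hk := le_or_gt k 2
    · exact Or.inl hk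
    · exact Or.inr ⟨k - 3, by omega⟩
  · rw [eq_zero_of_totalDegree_le_one (hq.trans (by omega)) h]
    exact zero_mem _
  · obtain ⟨u, hu, r, hr, rfl⟩ := Submodule.mem_sup.1
      (restrictTotalDegree_le_bubbleDiv_sup n ((mem_restrictTotalDegree _ _ _).2 hq))
    refine add_mem hu (bubbleDiv_mono (by omega) (mem_bubbleDiv_of_totalDegree_le_two
      ((mem_restrictTotalDegree _ _ _).1 hr) ?_))
    simpa using h.sub (vertexMeanZero_of_mem_bubbleDiv hu)

/-! ### Stability -/

lemma LinearMap.exists_le_mul_norm_sq {V : Type*} [NormedAddCommGroup V] [NormedSpace ℝ V]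
    [FiniteDimensional ℝ V] (A : V →ₗ[ℝ] V →ₗ[ℝ] ℝ) :
    ∃ C : ℝ, 0 < C ∧ ∀ x, A x x ≤ C * (‖x‖ * ‖x‖) := by
  refine ⟨‖A.toContinuousBilinearMap‖ + 1, by positivity, fun x => ?_⟩
  have hA := (le_abs_self _).trans (A.toContinuousBilinearMap.le_opNorm₂ x x)
  rw [LinearMap.toContinuousBilinearMap_apply] at hA
  nlinarith [mul_self_nonneg ‖x‖]

/-- On a finite-dimensional space every bilinear form is bounded by a positive definite one. -/
lemma LinearMap.exists_le_mul_of_posDef {V : Type*} [AddCommGroup V] [Module ℝ V]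
    [FiniteDimensional ℝ V] (A B : V →ₗ[ℝ] V →ₗ[ℝ] ℝ) (hsymm : ∀ x y, B x y = B y x)
    (hnonneg : ∀ x, 0 ≤ B x x) (hdef : ∀ x, B x x = 0 → x = 0) :
    ∃ C : ℝ, 0 < C ∧ ∀ x, A x x ≤ C * B x x := by
  let core : InnerProductSpace.Core ℝ V :=
    { inner := fun x y => B x y
      conj_inner_symm := fun x y => by simpa using hsymm y x
      re_inner_nonneg := fun x => by simpa using hnonneg x
      add_left := fun x y z => by simp
      smul_left := fun x y r => by simp
      definite := hdef }
  let _ : NormedAddCommGroup V := core.toNormedAddCommGroup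
  let _ : InnerProductSpace ℝ V := InnerProductSpace.ofCore core.toCore
  obtain ⟨C, hC, h⟩ := LinearMap.exists_le_mul_norm_sq A
  exact ⟨C, hC, fun x => (h x).trans_eq
    (congrArg (C * ·) (real_inner_self_eq_norm_mul_norm x).symm)⟩

/-- The `L²` inner product of polynomials on the reference triangle. -/
noncomputable def l2Form : MvPolynomial (Fin 2) ℝ →ₗ[ℝ] MvPolynomial (Fin 2) ℝ →ₗ[ℝ] ℝ :=
  LinearMap.mk₂ ℝ (fun p q => ∫ z in Tref, eval ![z.1, z.2] (p * q))
    (fun p p' q => by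
      simp only [add_mul, map_add]
      exact integral_add (integrableOn_Tref (continuous_eval_pair _))
        (integrableOn_Tref (continuous_eval_pair _)))
    (fun c p q => by
      simp only [smul_mul_assoc, smul_eval, smul_eq_mul]
      exact integral_const_mul _ _)
    (fun p q q' => by
      simp only [mul_add, map_add]
      exact integral_add (integrableOn_Tref (continuous_eval_pair _))
        (integrableOn_Tref (continuous_eval_pair _)))
    (fun c p q => by
      simp only [mul_smul_comm, smul_eval, smul_eq_mul]
      exact integral_const_mul _ _)

lemma l2Form_apply (p q : MvPolynomial (Fin 2) ℝ) :
    l2Form p q = ∫ z in Tref, eval ![z.1, z.2] (p * q) := rfl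

lemma l2Form_self (p : MvPolynomial (Fin 2) ℝ) :
    l2Form p p = ∫ z in Tref, (eval ![z.1, z.2] p) ^ 2 := by
  simp only [l2Form_apply, map_mul, sq]

lemma eq_zero_of_l2Form_self {p : MvPolynomial (Fin 2) ℝ} (h : l2Form p p = 0) : p = 0 :=
  mul_self_eq_zero.1 (eq_zero_of_setIntegral_Tref_eq_zero
    (fun z _ => by simpa using mul_self_nonneg _) h)

lemma integral_sum_sq (p q r s t u : MvPolynomial (Fin 2) ℝ) :
    ∫ z in Tref, ((eval ![z.1, z.2] p) ^ 2 + (eval ![z.1, z.2] q) ^ 2 +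
      ((eval ![z.1, z.2] r) ^ 2 + (eval ![z.1, z.2] s) ^ 2) +
      ((eval ![z.1, z.2] t) ^ 2 + (eval ![z.1, z.2] u) ^ 2)) =
    l2Form p p + l2Form q q + (l2Form r r + l2Form s s) + (l2Form t t + l2Form u u) := by
  have h : ∀ p : MvPolynomial (Fin 2) ℝ,
      Integrable (fun z : ℝ × ℝ => (eval ![z.1, z.2] p) ^ 2) (volume.restrict Tref) :=
    fun p => integrableOn_Tref ((continuous_eval_pair p).pow 2)
  have h2 : ∀ p q : MvPolynomial (Fin 2) ℝ,
      Integrable (fun z : ℝ × ℝ => (eval ![z.1, z.2] p) ^ 2 + (eval ![z.1, z.2] q) ^ 2)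
        (volume.restrict Tref) := fun p q => (h p).add (h q)
  have h4 : Integrable (fun z : ℝ × ℝ => (eval ![z.1, z.2] p) ^ 2 + (eval ![z.1, z.2] q) ^ 2 +
      ((eval ![z.1, z.2] r) ^ 2 + (eval ![z.1, z.2] s) ^ 2)) (volume.restrict Tref) :=
    (h2 p q).add (h2 r s)
  simp only [l2Form_self]
  rw [integral_add h4 (h2 t u), integral_add (h2 p q) (h2 r s), integral_add (h p) (h q),
    integral_add (h r) (h s), integral_add (h t) (h u)]

/-- For every `k ≥ 1` there is a constant `C > 0`, depending only on `k`, such that every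
polynomial `q` of total degree at most `k − 1` vanishing at the three vertices of the
reference triangle and with zero integral over it is the divergence `∂₁v₁ + ∂₂v₂` of a
pair of polynomials `(v₁,v₂)` of total degree at most `k` vanishing on `∂T̂`, with the
stability bound `‖v‖²_{H¹(T̂)} ≤ C ‖q‖²_{L²(T̂)}`. -/
theorem stable_divergence_lifting (k : ℕ) (hk : 1 ≤ k) :
    ∃ C : ℝ, 0 < C ∧ ∀ q : MvPolynomial (Fin 2) ℝ,
      q.totalDegree ≤ k - 1 →
      eval ![0, 0] q = 0 → eval ![1, 0] q = 0 → eval ![0, 1] q = 0 →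
      (∫ p in Tref, eval ![p.1, p.2] q) = 0 →
      ∃ v₁ v₂ : MvPolynomial (Fin 2) ℝ,
        v₁.totalDegree ≤ k ∧ v₂.totalDegree ≤ k ∧
        (∀ x y : ℝ, OnBdryT x y → eval ![x, y] v₁ = 0 ∧ eval ![x, y] v₂ = 0) ∧
        pderiv (0 : Fin 2) v₁ + pderiv (1 : Fin 2) v₂ = q ∧
        (∫ p in Tref,
            ((eval ![p.1, p.2] v₁) ^ 2 + (eval ![p.1, p.2] v₂) ^ 2 +
              ((eval ![p.1, p.2] (pderiv (0 : Fin 2) v₁)) ^ 2 +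
                (eval ![p.1, p.2] (pderiv (1 : Fin 2) v₁)) ^ 2) +
              ((eval ![p.1, p.2] (pderiv (0 : Fin 2) v₂)) ^ 2 +
                (eval ![p.1, p.2] (pderiv (1 : Fin 2) v₂)) ^ 2)))
          ≤ C * ∫ p in Tref, (eval ![p.1, p.2] q) ^ 2 := by
  let P := restrictTotalDegree (Fin 2) ℝ k
  have : FiniteDimensional ℝ (P.prod P) :=
    Module.Finite.iff_fg.2 ((Module.Finite.iff_fg.1 inferInstance).prod
      (Module.Finite.iff_fg.1 inferInstance))
  have : FiniteDimensional ℝ (bubbleFields k) :=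
    Submodule.finiteDimensional_of_le (inf_le_left : bubbleFields k ≤ P.prod P)
  let D := polyDiv.domRestrict (bubbleFields k)
  obtain ⟨g, hg⟩ := D.rangeRestrict.exists_rightInverse_of_surjective D.range_rangeRestrict
  let L₁ := LinearMap.fst ℝ _ _ ∘ₗ (bubbleFields k).subtype ∘ₗ g
  let L₂ := LinearMap.snd ℝ _ _ ∘ₗ (bubbleFields k).subtype ∘ₗ g
  let pull := fun L : LinearMap.range D →ₗ[ℝ] MvPolynomial (Fin 2) ℝ => l2Form.compl₁₂ L L
  let der := fun i : Fin 2 => (pderiv (R := ℝ) i).toLinearMap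
  obtain ⟨C, hC, hbound⟩ := LinearMap.exists_le_mul_of_posDef
    (pull L₁ + pull L₂ + (pull (der 0 ∘ₗ L₁) + pull (der 1 ∘ₗ L₁)) +
      (pull (der 0 ∘ₗ L₂) + pull (der 1 ∘ₗ L₂)))
    (pull (LinearMap.range D).subtype)
    (fun p q => by simp [pull, l2Form_apply, mul_comm])
    (fun p => by
      simp only [pull, LinearMap.compl₁₂_apply, l2Form_self]
      exact integral_nonneg fun z => sq_nonneg _)
    (fun p hp => Subtype.ext (eq_zero_of_l2Form_self hp))
  refine ⟨C, hC, fun q hdeg h1 h2 h3 h4 => ?_⟩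
  obtain ⟨v, hv, hvq⟩ := mem_bubbleDiv hdeg ⟨h1, h2, h3, h4⟩
  let q' : LinearMap.range D := ⟨q, ⟨v, hv⟩, hvq⟩
  obtain ⟨⟨hd1, hd2⟩, hb1, hb2⟩ := mem_bubbleFields.1 (g q').2
  refine ⟨(g q').1.1, (g q').1.2, hd1, hd2, fun x y h =>
    ⟨eval_eq_zero_of_bubble_dvd hb1 h, eval_eq_zero_of_bubble_dvd hb2 h⟩,
    congrArg Subtype.val (LinearMap.congr_fun hg q'), ?_⟩
  rw [integral_sum_sq, ← l2Form_self]
  exact hbound q'
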